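/- arXiv:1911.12891 — 6 statements merged into one kernel-verified Lean document; each statement's English description precedes it below -/
import Mathlib

section
/- Let n ≥ m ≥ 1 be integers. There exists a K-linear equivalence φ from K^n ⊗ K^m to the direct sum ⊕_{i=0}^{m−1} K^{n+m−1−2i} such that φ ∘ (N_n ⊗ id + id ⊗ N_m) = (⊕_{i=0}^{m−1} N_{n+m−1−2i}) ∘ φ. (This is the characteristic-zero tensor product decomposition of segments underlying Lemma 2.2: [0,n−1] ⊗ [0,m−1] = [0,n+m−2] ⊕ [1,n+m−3] ⊕ ⋯ ⊕ [m−1,n−1].) -/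
open TensorProduct

/-- The nilpotent shift operator `N_r` on `K^r`, sending the standard basis vector `e_j` to
`e_{j+1}` for `0 ≤ j < r-1` and `e_{r-1}` to `0` (the monodromy operator of the segment
`[0, r-1]`). -/
noncomputable def shiftOp (K : Type*) [Field K] (r : ℕ) : (Fin r → K) →ₗ[K] (Fin r → K) where
  toFun x k := if h : (k : ℕ) = 0 then 0 else x ⟨(k : ℕ) - 1, by have := k.isLt; omega⟩
  map_add' x y := by funext k; by_cases h : (k : ℕ) = 0 <;> simp [h]
  map_smul' a x := by funext k; by_cases h : (k : ℕ) = 0 <;> simp [h]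

/-- The operator `N_n ⊗ id + id ⊗ N_m` on `K^n ⊗ K^m`. -/
noncomputable def tensorShift (K : Type*) [Field K] (n m : ℕ) :
    ((Fin n → K) ⊗[K] (Fin m → K)) →ₗ[K] ((Fin n → K) ⊗[K] (Fin m → K)) :=
  TensorProduct.map (shiftOp K n) LinearMap.id + TensorProduct.map LinearMap.id (shiftOp K m)

section Shift

variable {K : Type*} [Field K]

/-- The raising operator `e_j ↦ j (r - j) e_{j-1}` of the irreducible `sl₂`-representation on `K^r`
whose lowering operator is `shiftOp K r`. -/
noncomputable def raiseOp (K : Type*) [Field K] (r : ℕ) : (Fin r → K) →ₗ[K] (Fin r → K) where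
  toFun x k := if h : (k : ℕ) + 1 < r then ((k : K) + 1) * (r - k - 1) * x ⟨(k : ℕ) + 1, h⟩ else 0
  map_add' x y := by funext k; by_cases h : (k : ℕ) + 1 < r <;> simp [h, mul_add]
  map_smul' a x := by funext k; by_cases h : (k : ℕ) + 1 < r <;> simp [h, mul_left_comm]

/-- The weight operator `e_j ↦ (r - 1 - 2 j) e_j`. -/
noncomputable def weightOp (K : Type*) [Field K] (r : ℕ) : (Fin r → K) →ₗ[K] (Fin r → K) where
  toFun x k := ((r : K) - 1 - 2 * k) * x k
  map_add' x y := by funext k; simp [mul_add]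
  map_smul' a x := by funext k; simp [mul_left_comm]

theorem raiseOp_shiftOp (r : ℕ) (x : Fin r → K) :
    raiseOp K r (shiftOp K r x) = shiftOp K r (raiseOp K r x) + weightOp K r x := by
  funext ⟨k, hk⟩
  rcases k with _ | k
  · by_cases h : 1 < r
    · simp [raiseOp, shiftOp, weightOp, h]
    · obtain rfl : r = 1 := by omega
      simp [raiseOp, shiftOp, weightOp]
  · by_cases h : k + 1 + 1 < r
    · simp [raiseOp, shiftOp, weightOp, h, hk]
      ring
    · obtain rfl : r = k + 1 + 1 := by omega
      simp [raiseOp, shiftOp, weightOp]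
      ring

theorem weightOp_shiftOp (r : ℕ) (x : Fin r → K) :
    weightOp K r (shiftOp K r x) = shiftOp K r (weightOp K r x) - (2 : K) • shiftOp K r x := by
  funext ⟨k, hk⟩
  rcases k with _ | k
  · simp [shiftOp, weightOp]
  · simp [shiftOp, weightOp]
    ring

theorem shiftOp_pow_apply_of_lt {r : ℕ} (j : ℕ) (x : Fin r → K) (k : Fin r) (hk : (k : ℕ) < j) :
    (shiftOp K r ^ j) x k = 0 := by
  induction j generalizing k with
  | zero => omega
  | succ j ih =>
    rw [pow_succ', Module.End.mul_apply]
    by_cases h : (k : ℕ) = 0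
    · simp [shiftOp, h]
    · have := ih ⟨(k : ℕ) - 1, by omega⟩ (by simp; omega)
      simpa [shiftOp, h] using this

theorem shiftOp_pow_eq_zero {r j : ℕ} (h : r ≤ j) : shiftOp K r ^ j = 0 := by
  ext x k
  exact shiftOp_pow_apply_of_lt j _ k (by omega)

theorem apply_eq_zero_of_shiftOp_eq_zero {r : ℕ} {x : Fin r → K} (hx : shiftOp K r x = 0)
    (k : Fin r) (hk : (k : ℕ) + 1 < r) : x k = 0 := by
  simpa [shiftOp] using congrFun hx ⟨(k : ℕ) + 1, hk⟩

theorem sum_shiftOp_smul_pow {V : Type*} [AddCommGroup V] [Module K V] (N : Module.End K V) (w : V)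
    (r : ℕ) (hw : (N ^ r) w = 0) (x : Fin r → K) :
    ∑ k, shiftOp K r x k • (N ^ (k : ℕ)) w = N (∑ k, x k • (N ^ (k : ℕ)) w) := by
  rcases r with _ | r
  · simp
  · have h (k : ℕ) : N ((N ^ k) w) = (N ^ (k + 1)) w := by rw [pow_succ', Module.End.mul_apply]
    rw [map_sum, Fin.sum_univ_succ, Fin.sum_univ_castSucc]
    simp only [map_smul, h]
    simp [shiftOp, hw]
    rfl

/-- The `j`-th standard basis vector of `K^r`, which is `0` for `r ≤ j`. -/
def stdVec (K : Type*) [Field K] (r j : ℕ) : Fin r → K := fun k => if (k : ℕ) = j then 1 else 0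

theorem raiseOp_stdVec_zero (r : ℕ) : raiseOp K r (stdVec K r 0) = 0 := by
  funext k
  simp [raiseOp, stdVec]

theorem raiseOp_stdVec_succ {r j : ℕ} (hj : j + 1 < r) :
    raiseOp K r (stdVec K r (j + 1)) = (((j : K) + 1) * (r - j - 1)) • stdVec K r j := by
  funext k
  by_cases h : (k : ℕ) = j
  · simp [raiseOp, stdVec, h, hj]
  · simp [raiseOp, stdVec, h]

theorem weightOp_stdVec (r j : ℕ) :
    weightOp K r (stdVec K r j) = ((r : K) - 1 - 2 * j) • stdVec K r j := by
  funext k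
  by_cases h : (k : ℕ) = j
  · simp [weightOp, stdVec, h]
  · simp [weightOp, stdVec, h]

end Shift

section Sl2

variable {K V : Type*} [Field K] [AddCommGroup V] [Module K V] {N E H : Module.End K V}

theorem weight_pow_apply (hHN : ∀ v, H (N v) = N (H v) - (2 : K) • N v) {μ : K} {w : V}
    (hw : H w = μ • w) (k : ℕ) : H ((N ^ k) w) = (μ - 2 * k) • (N ^ k) w := by
  induction k with
  | zero => simp [hw]
  | succ k ih =>
    rw [pow_succ', Module.End.mul_apply, hHN, ih, map_smul]
    push_cast
    module

theorem raise_pow_succ_apply (hEN : ∀ v, E (N v) = N (E v) + H v)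
    (hHN : ∀ v, H (N v) = N (H v) - (2 : K) • N v) {μ : K} {w : V}
    (hw : H w = μ • w) (hE : E w = 0) (k : ℕ) :
    E ((N ^ (k + 1)) w) = ((k + 1) * (μ - k)) • (N ^ k) w := by
  induction k with
  | zero => simp [hEN, hE, hw]
  | succ k ih =>
    rw [pow_succ', Module.End.mul_apply, hEN, ih, weight_pow_apply hHN hw, map_smul,
      ← Module.End.mul_apply, ← pow_succ']
    push_cast
    module

theorem pow_apply_ne_zero_of_primitive [CharZero K] (hEN : ∀ v, E (N v) = N (E v) + H v)
    (hHN : ∀ v, H (N v) = N (H v) - (2 : K) • N v) {μ : K} {w : V}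
    (hw : H w = μ • w) (hE : E w = 0) (hw0 : w ≠ 0) (k : ℕ) (hμ : ∀ j < k, μ ≠ j) :
    (N ^ k) w ≠ 0 := by
  induction k with
  | zero => simpa
  | succ k ih =>
    intro h
    have h1 := raise_pow_succ_apply hEN hHN hw hE k
    rw [h, map_zero, eq_comm, smul_eq_zero, mul_eq_zero, sub_eq_zero] at h1
    rcases h1 with (h1 | h1) | h1
    · exact Nat.cast_add_one_ne_zero k h1
    · exact hμ k (by omega) h1
    · exact ih (fun j hj => hμ j (by omega)) h1

theorem pow_succ_apply_eq_zero_of_primitive [CharZero K] (hEN : ∀ v, E (N v) = N (E v) + H v)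
    (hHN : ∀ v, H (N v) = N (H v) - (2 : K) • N v) (hN : IsNilpotent N) {l : ℕ} {w : V}
    (hw : H w = (l : K) • w) (hE : E w = 0) : (N ^ (l + 1)) w = 0 := by
  by_contra h
  obtain ⟨k, hk⟩ := hN
  refine pow_apply_ne_zero_of_primitive hEN hHN (weight_pow_apply hHN hw (l + 1)) ?_ h k ?_
    (by simp [hk])
  · simp [raise_pow_succ_apply hEN hHN hw hE]
  · intro j _ hj
    have : ((l + j + 2 * 1 : ℕ) : K) = 0 := by
      push_cast at hj ⊢
      linear_combination -hj
    exact absurd (Nat.cast_eq_zero.mp this) (by omega)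

end Sl2

theorem LinearMap.injective_of_disjoint_ker_of_isNilpotent {R M V : Type*} [Ring R]
    [AddCommGroup M] [Module R M] [AddCommGroup V] [Module R V] {f : M →ₗ[R] V}
    {S : Module.End R M} {N : Module.End R V} (hS : IsNilpotent S) (hf : ∀ x, f (S x) = N (f x))
    (h : ∀ x, S x = 0 → f x = 0 → x = 0) : Function.Injective f := by
  have key (j : ℕ) : ∀ x, (S ^ j) x = 0 → f x = 0 → x = 0 := by
    induction j with
    | zero => exact fun x hx _ => by simpa using hx
    | succ j ih =>
      intro x hx hfx
      refine h x (ih (S x) ?_ ?_) hfx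
      · rwa [pow_succ] at hx
      · rw [hf, hfx, map_zero]
  obtain ⟨j, hj⟩ := hS
  exact (injective_iff_map_eq_zero f).mpr fun x hx => key j x (by simp [hj]) hx

section Tensor

variable {K : Type*} [Field K]

/-- The action of `A ⊗ id + id ⊗ B` on a tensor product. -/
noncomputable def tensorAct {V W : Type*} [AddCommGroup V] [Module K V] [AddCommGroup W]
    [Module K W] (A : Module.End K V) (B : Module.End K W) : Module.End K (V ⊗[K] W) :=
  TensorProduct.map A LinearMap.id + TensorProduct.map LinearMap.id B

theorem tensorAct_tmul {V W : Type*} [AddCommGroup V] [Module K V] [AddCommGroup W]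
    [Module K W] (A : Module.End K V) (B : Module.End K W) (v : V) (w : W) :
    tensorAct A B (v ⊗ₜ w) = A v ⊗ₜ w + v ⊗ₜ B w := by
  simp [tensorAct]

theorem tensorShift_tmul (n m : ℕ) (x : Fin n → K) (y : Fin m → K) :
    tensorShift K n m (x ⊗ₜ y) = shiftOp K n x ⊗ₜ y + x ⊗ₜ shiftOp K m y := by
  simp [tensorShift]

theorem isNilpotent_tensorShift (n m : ℕ) :
    IsNilpotent (tensorShift K n m : Module.End K ((Fin n → K) ⊗[K] (Fin m → K))) := by
  refine Commute.isNilpotent_add ?_ ⟨n, ?_⟩ ⟨m, ?_⟩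
  · ext
    simp
  · rw [TensorProduct.map_pow, shiftOp_pow_eq_zero le_rfl, TensorProduct.map_zero_left]
  · rw [TensorProduct.map_pow, shiftOp_pow_eq_zero le_rfl, TensorProduct.map_zero_right]

theorem tensorRaise_tensorShift (n m : ℕ) (v : (Fin n → K) ⊗[K] (Fin m → K)) :
    tensorAct (raiseOp K n) (raiseOp K m) (tensorShift K n m v) =
      tensorShift K n m (tensorAct (raiseOp K n) (raiseOp K m) v) +
        tensorAct (weightOp K n) (weightOp K m) v := by
  induction v with
  | zero => simp
  | add v w hv hw => simp only [map_add, hv, hw]; abel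
  | tmul x y =>
    simp only [tensorShift_tmul, tensorAct_tmul, map_add, raiseOp_shiftOp, TensorProduct.add_tmul,
      TensorProduct.tmul_add]
    abel

theorem tensorWeight_tensorShift (n m : ℕ) (v : (Fin n → K) ⊗[K] (Fin m → K)) :
    tensorAct (weightOp K n) (weightOp K m) (tensorShift K n m v) =
      tensorShift K n m (tensorAct (weightOp K n) (weightOp K m) v) -
        (2 : K) • tensorShift K n m v := by
  induction v with
  | zero => simp
  | add v w hv hw => simp only [map_add, hv, hw, smul_add]; abel
  | tmul x y =>
    simp only [tensorShift_tmul, tensorAct_tmul, map_add, weightOp_shiftOp, TensorProduct.sub_tmul,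
      TensorProduct.tmul_sub, TensorProduct.tmul_smul, TensorProduct.smul_tmul', smul_add]
    abel

/-- The coefficients of the primitive vector of degree `i` in `K^n ⊗ K^m`. -/
noncomputable def primitiveCoeff (K : Type*) [Field K] (n m i : ℕ) : ℕ → K
  | 0 => 1
  | a + 1 => -primitiveCoeff K n m i a * ((i - a) * (m - (i - a))) / ((a + 1) * (n - a - 1))

/-- The primitive vector of degree `i` in `K^n ⊗ K^m`. -/
noncomputable def primitiveVec (K : Type*) [Field K] (n m i : ℕ) :
    (Fin n → K) ⊗[K] (Fin m → K) :=
  ∑ a ∈ Finset.range (i + 1), primitiveCoeff K n m i a • (stdVec K n a ⊗ₜ stdVec K m (i - a))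

theorem primitiveVec_ne_zero {n m i : ℕ} (hn : 0 < n) (hi : i < m) :
    primitiveVec K n m i ≠ 0 := by
  intro h
  have := congrArg (LinearMap.mul' K K ∘ₗ TensorProduct.map
    (LinearMap.proj (⟨0, hn⟩ : Fin n)) (LinearMap.proj (⟨i, hi⟩ : Fin m))) h
  rw [primitiveVec, map_sum, Finset.sum_range_succ', Finset.sum_eq_zero] at this
  · simp [stdVec, primitiveCoeff] at this
  · intro a _
    simp [stdVec]

theorem tensorWeight_primitiveVec (n m i : ℕ) :
    tensorAct (weightOp K n) (weightOp K m) (primitiveVec K n m i) =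
      ((n : K) + m - 2 - 2 * i) • primitiveVec K n m i := by
  rw [primitiveVec, map_sum, Finset.smul_sum]
  refine Finset.sum_congr rfl fun a ha => ?_
  have ha : a ≤ i := by simpa [Nat.lt_succ_iff] using ha
  rw [map_smul, tensorAct_tmul, weightOp_stdVec, weightOp_stdVec, TensorProduct.tmul_smul,
    ← TensorProduct.smul_tmul', Nat.cast_sub ha]
  module

theorem tensorRaise_primitiveVec [CharZero K] {n m i : ℕ} (hn : i < n) (hm : i < m) :
    tensorAct (raiseOp K n) (raiseOp K m) (primitiveVec K n m i) = 0 := by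
  simp only [primitiveVec, map_sum, map_smul, tensorAct_tmul, smul_add, Finset.sum_add_distrib]
  rw [Finset.sum_range_succ', Finset.sum_range_succ (n := i), raiseOp_stdVec_zero, Nat.sub_self,
    raiseOp_stdVec_zero, TensorProduct.zero_tmul, TensorProduct.tmul_zero, smul_zero, smul_zero,
    add_zero, add_zero, ← Finset.sum_add_distrib]
  refine Finset.sum_eq_zero fun a ha => ?_
  obtain ⟨b, rfl⟩ : ∃ b, i = a + b + 1 := ⟨i - a - 1, by have := Finset.mem_range.mp ha; omega⟩
  rw [show a + b + 1 - (a + 1) = b by omega, show a + b + 1 - a = b + 1 by omega,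
    raiseOp_stdVec_succ (by omega), raiseOp_stdVec_succ (by omega), TensorProduct.tmul_smul,
    ← TensorProduct.smul_tmul', smul_smul, smul_smul, ← add_smul, primitiveCoeff]
  have h1 : (a : K) + 1 ≠ 0 := Nat.cast_add_one_ne_zero a
  have h2 : (n : K) - a - 1 ≠ 0 := by
    obtain ⟨c, rfl⟩ : ∃ c, n = a + 1 + (c + 1) := ⟨n - a - 2, by omega⟩
    have := Nat.cast_add_one_ne_zero (R := K) c
    push_cast
    convert this using 1
    ring
  convert zero_smul K _
  push_cast
  field_simp
  ring

end Tensor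

theorem sum_segment_lengths {n m : ℕ} (hmn : m ≤ n) :
    ∑ i : Fin m, (n + m - 1 - 2 * (i : ℕ)) = n * m := by
  have key (j : ℕ) (hj : j ≤ m) :
      ∑ i ∈ Finset.range j, (n + m - 1 - 2 * i) = j * (n + m - j) := by
    induction j with
    | zero => simp
    | succ j ih =>
      rw [Finset.sum_range_succ, ih (by omega)]
      zify [show j ≤ n + m by omega, show j + 1 ≤ n + m by omega, show 1 ≤ n + m by omega,
        show 2 * j ≤ n + m - 1 by omega]
      ring
  rw [Fin.sum_univ_eq_sum_range (fun i => n + m - 1 - 2 * i), key m le_rfl, Nat.add_sub_cancel,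
    mul_comm]

/-- Characteristic-zero tensor product decomposition of segments
`[0,n-1] ⊗ [0,m-1] = [0,n+m-2] ⊕ [1,n+m-3] ⊕ ⋯ ⊕ [m-1,n-1]`:
there is a `K`-linear equivalence `φ` from `K^n ⊗ K^m` to `⊕_{i=0}^{m-1} K^{n+m-1-2i}`
intertwining `N_n ⊗ id + id ⊗ N_m` with `⊕_{i=0}^{m-1} N_{n+m-1-2i}`. -/
theorem segment_tensor_decomposition (K : Type*) [Field K] [CharZero K]
    (n m : ℕ) (hm : 1 ≤ m) (hmn : m ≤ n) :
    ∃ φ : ((Fin n → K) ⊗[K] (Fin m → K)) ≃ₗ[K] (∀ i : Fin m, Fin (n + m - 1 - 2 * (i : ℕ)) → K),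
      ∀ v : (Fin n → K) ⊗[K] (Fin m → K),
        φ (tensorShift K n m v)
          = (LinearMap.pi fun i : Fin m =>
              (shiftOp K (n + m - 1 - 2 * (i : ℕ))).comp (LinearMap.proj i)) (φ v) := by
  set N : Module.End K ((Fin n → K) ⊗[K] (Fin m → K)) := tensorShift K n m
  have hEN := tensorRaise_tensorShift (K := K) n m
  have hHN := tensorWeight_tensorShift (K := K) n m
  let w (i : Fin m) := primitiveVec K n m i
  have hE (i : Fin m) : tensorAct (raiseOp K n) (raiseOp K m) (w i) = 0 :=
    tensorRaise_primitiveVec (by omega) i.isLt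
  have hH (i : Fin m) : tensorAct (weightOp K n) (weightOp K m) (w i) =
      ((n + m - 1 - 2 * (i : ℕ) - 1 : ℕ) : K) • w i := by
    rw [tensorWeight_primitiveVec]
    congr 1
    obtain ⟨c, hc⟩ : ∃ c, n + m = 2 + 2 * (i : ℕ) + c := ⟨n + m - 2 - 2 * i, by omega⟩
    rw [show n + m - 1 - 2 * (i : ℕ) - 1 = c by omega, ← Nat.cast_add, hc]
    push_cast
    ring
  have hw0 (i : Fin m) : w i ≠ 0 := primitiveVec_ne_zero (by omega) i.isLt
  have hpow (i : Fin m) : (N ^ (n + m - 1 - 2 * (i : ℕ))) (w i) = 0 := by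
    have := pow_succ_apply_eq_zero_of_primitive hEN hHN (isNilpotent_tensorShift n m) (hH i) (hE i)
    rwa [show n + m - 1 - 2 * (i : ℕ) - 1 + 1 = n + m - 1 - 2 * (i : ℕ) by omega] at this
  have hlin : LinearIndependent K
      fun i : Fin m => (N ^ (n + m - 1 - 2 * (i : ℕ) - 1)) (w i) := by
    refine Module.End.eigenvectors_linearIndependent' (tensorAct (weightOp K n) (weightOp K m))
      (fun i : Fin m => -((n + m - 1 - 2 * (i : ℕ) - 1 : ℕ) : K)) ?_ _ fun i =>
      Module.End.hasEigenvector_iff.mpr ⟨Module.End.mem_eigenspace_iff.mpr ?_, ?_⟩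
    · intro i j hij
      have := Nat.cast_injective (neg_injective hij)
      ext
      omega
    · rw [weight_pow_apply hHN (hH i)]
      congr 1
      ring
    · exact pow_apply_ne_zero_of_primitive hEN hHN (hH i) (hE i) (hw0 i) _ fun j hj h =>
        hj.ne' (Nat.cast_injective h)
  let S : Module.End K (∀ i : Fin m, Fin (n + m - 1 - 2 * (i : ℕ)) → K) :=
    LinearMap.pi fun i : Fin m => (shiftOp K (n + m - 1 - 2 * (i : ℕ))).comp (LinearMap.proj i)
  let ψ : (∀ i : Fin m, Fin (n + m - 1 - 2 * (i : ℕ)) → K) →ₗ[K]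
      (Fin n → K) ⊗[K] (Fin m → K) :=
    ∑ i : Fin m, (Fintype.linearCombination K fun k : Fin (n + m - 1 - 2 * (i : ℕ)) =>
      (N ^ (k : ℕ)) (w i)) ∘ₗ LinearMap.proj i
  have hψ (x) : ψ x = ∑ i, ∑ k, x i k • (N ^ (k : ℕ)) (w i) := by
    simp [ψ, Fintype.linearCombination_apply]
  have hψS (x) : ψ (S x) = N (ψ x) := by
    rw [hψ, hψ, map_sum]
    exact Finset.sum_congr rfl fun i _ => sum_shiftOp_smul_pow N (w i) _ (hpow i) (x i)
  have hS : IsNilpotent S := by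
    have h (j : ℕ) (x) (i : Fin m) : (S ^ j) x i = (shiftOp K _ ^ j) (x i) := by
      induction j with
      | zero => rfl
      | succ j ih =>
        rw [pow_succ', pow_succ', Module.End.mul_apply, Module.End.mul_apply, ← ih]
        rfl
    refine ⟨n + m, LinearMap.ext fun x => funext fun i => ?_⟩
    rw [h, shiftOp_pow_eq_zero (by omega)]
    rfl
  have hinj : Function.Injective ψ := by
    refine LinearMap.injective_of_disjoint_ker_of_isNilpotent hS hψS fun x hSx hx => ?_
    have hx0 (i : Fin m) := apply_eq_zero_of_shiftOp_eq_zero (congrFun hSx i)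
    let top (i : Fin m) : Fin (n + m - 1 - 2 * (i : ℕ)) :=
      ⟨n + m - 1 - 2 * (i : ℕ) - 1, by omega⟩
    have hne (i : Fin m) (k) (hk : k ≠ top i) : x i k = 0 :=
      hx0 i k (by have : (k : ℕ) ≠ top i := fun h => hk (Fin.ext h)
                  simp only [top] at this
                  omega)
    have hsum : ∑ i, x i (top i) • (N ^ (n + m - 1 - 2 * (i : ℕ) - 1)) (w i) = 0 := by
      rw [← hx, hψ]
      refine Finset.sum_congr rfl fun i _ => ?_
      rw [Fintype.sum_eq_single (top i)]
      intro k hk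
      rw [hne i k hk, zero_smul]
    have htop := Fintype.linearIndependent_iff.mp hlin _ hsum
    funext i k
    by_cases hk : k = top i
    · exact hk ▸ htop i
    · exact hne i k hk
  have hrank : Module.finrank K (∀ i : Fin m, Fin (n + m - 1 - 2 * (i : ℕ)) → K) =
      Module.finrank K ((Fin n → K) ⊗[K] (Fin m → K)) := by
    simp [Module.finrank_pi_fintype, sum_segment_lengths hmn]
  let e := LinearEquiv.ofInjectiveOfFinrankEq ψ hinj hrank
  refine ⟨e.symm, fun v => e.injective ?_⟩
  obtain ⟨x, rfl⟩ := e.surjective v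
  rw [e.apply_symm_apply, e.symm_apply_apply]
  exact (hψS x).symm
end

section
/- Let n ≥ m ≥ 1 be integers. The kernel of the operator N_n ⊗ id + id ⊗ N_m on K^n ⊗ K^m has dimension exactly m. -/
open TensorProduct

/-- In the coordinates given by `TensorProduct.piScalarRight`, the operator `N_n ⊗ id + id ⊗ N_m`
sends an array `g` to the array `(j, i) ↦ g j (i - 1) + g (j - 1) i`, where entries outside the
array are zero. -/
theorem piScalarRight_tensorShift (K : Type*) [Field K] (n m : ℕ)
    (t : (Fin n → K) ⊗[K] (Fin m → K)) (j : Fin m) (i : Fin n) :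
    TensorProduct.piScalarRight K K (Fin n → K) (Fin m) (tensorShift K n m t) j i =
      (if h : (i : ℕ) = 0 then 0 else
        TensorProduct.piScalarRight K K (Fin n → K) (Fin m) t j ⟨(i : ℕ) - 1, by omega⟩) +
      (if h : (j : ℕ) = 0 then 0 else
        TensorProduct.piScalarRight K K (Fin n → K) (Fin m) t ⟨(j : ℕ) - 1, by omega⟩ i) := by
  induction t with
  | zero => simp
  | add x y hx hy =>
    simp only [map_add, Pi.add_apply, hx, hy]
    split_ifs <;> ring
  | tmul x y =>
    simp only [tensorShift, LinearMap.add_apply, TensorProduct.map_tmul, map_add, Pi.add_apply,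
      LinearMap.id_apply, TensorProduct.piScalarRight_apply, TensorProduct.piScalarRightHom_tmul,
      Pi.smul_apply, smul_eq_mul, shiftOp, LinearMap.coe_mk, AddHom.coe_mk]
    split_ifs <;> simp

theorem mem_ker_tensorShift_iff (K : Type*) [Field K] (n m : ℕ)
    (t : (Fin n → K) ⊗[K] (Fin m → K)) :
    t ∈ LinearMap.ker (tensorShift K n m) ↔ ∀ (j : Fin m) (i : Fin n),
      (if h : (i : ℕ) = 0 then 0 else
        TensorProduct.piScalarRight K K (Fin n → K) (Fin m) t j ⟨(i : ℕ) - 1, by omega⟩) +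
      (if h : (j : ℕ) = 0 then 0 else
        TensorProduct.piScalarRight K K (Fin n → K) (Fin m) t ⟨(j : ℕ) - 1, by omega⟩ i) = 0 := by
  rw [LinearMap.mem_ker,
    ← (TensorProduct.piScalarRight K K (Fin n → K) (Fin m)).map_eq_zero_iff, funext_iff]
  simp only [funext_iff, piScalarRight_tensorShift, Pi.zero_apply]

/-- The coordinates of an element of `K^n ⊗ K^m` along `e_{n-1} ⊗ e_j`, for `0 ≤ j < m`. -/
noncomputable def lastCoordinates (K : Type*) [Field K] (n m : ℕ) (hn : 0 < n) :
    ((Fin n → K) ⊗[K] (Fin m → K)) →ₗ[K] (Fin m → K) :=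
  LinearMap.pi fun j => LinearMap.proj (⟨n - 1, by omega⟩ : Fin n) ∘ₗ LinearMap.proj j ∘ₗ
    (TensorProduct.piScalarRight K K (Fin n → K) (Fin m)).toLinearMap

theorem lastCoordinates_apply (K : Type*) [Field K] (n m : ℕ) (hn : 0 < n)
    (t : (Fin n → K) ⊗[K] (Fin m → K)) (j : Fin m) :
    lastCoordinates K n m hn t j =
      TensorProduct.piScalarRight K K (Fin n → K) (Fin m) t j ⟨n - 1, by omega⟩ := rfl

theorem injective_lastCoordinates_domRestrict (K : Type*) [Field K] (n m : ℕ) (hn : 0 < n) :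
    Function.Injective
      ((lastCoordinates K n m hn).domRestrict (LinearMap.ker (tensorShift K n m))) := by
  refine (injective_iff_map_eq_zero _).mpr ?_
  rintro ⟨t, ht⟩ h
  rw [mem_ker_tensorShift_iff] at ht
  have key : ∀ (k : ℕ) (i : Fin n) (j : Fin m), (i : ℕ) + k = n - 1 →
      TensorProduct.piScalarRight K K (Fin n → K) (Fin m) t j i = 0 := by
    intro k
    induction k with
    | zero =>
      intro i j hi
      rw [show i = ⟨n - 1, by omega⟩ from Fin.ext hi]
      exact congrFun h j
    | succ k ih =>
      intro i j hi
      have hij := ht j ⟨i + 1, by omega⟩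
      by_cases hj : (j : ℕ) = 0
      · simpa [hj] using hij
      · simpa [hj, ih ⟨i + 1, by omega⟩ ⟨j - 1, by omega⟩ (by simp; omega)] using hij
  rw [Subtype.ext_iff, ← (TensorProduct.piScalarRight K K (Fin n → K) (Fin m)).injective.eq_iff]
  ext j i
  simpa using key (n - 1 - i) i j (by omega)

theorem surjective_lastCoordinates_domRestrict (K : Type*) [Field K] (n m : ℕ) (hn : 0 < n)
    (hmn : m ≤ n) :
    Function.Surjective
      ((lastCoordinates K n m hn).domRestrict (LinearMap.ker (tensorShift K n m))) := by
  intro c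
  let g : Fin m → Fin n → K := fun j i => if h : n - 1 ≤ (i : ℕ) + j then
    (-1) ^ (n - 1 - (i : ℕ)) * c ⟨(i : ℕ) + j - (n - 1), by omega⟩ else 0
  refine ⟨⟨(TensorProduct.piScalarRight K K (Fin n → K) (Fin m)).symm g, ?_⟩, ?_⟩
  · rw [mem_ker_tensorShift_iff]
    rintro ⟨j, hj⟩ ⟨i, hi⟩
    simp only [LinearEquiv.apply_symm_apply, g]
    rcases i with _ | i <;> rcases j with _ | j
    · simp
    · simp; omega
    · simp; omega
    · have hsign : n - 1 - i = n - 1 - (i + 1) + 1 := by omega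
      have hindex : i + (j + 1) = i + 1 + j := by omega
      simp only [Nat.add_sub_cancel, hindex, hsign, Nat.add_eq_zero_iff, one_ne_zero, and_false,
        dite_false]
      split_ifs <;> ring
  · ext j
    have hj : ¬ n - 1 + (j : ℕ) + 1 < n := by omega
    simp [lastCoordinates_apply, g, hj]

/-- The kernel of the operator `N_n ⊗ id + id ⊗ N_m` on `K^n ⊗ K^m` has dimension exactly `m`
(for `n ≥ m ≥ 1`, `K` of characteristic zero). -/
theorem finrank_ker_tensorShift (K : Type*) [Field K] [CharZero K]
    (n m : ℕ) (hm : 1 ≤ m) (hmn : m ≤ n) :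
    Module.finrank K (LinearMap.ker (tensorShift K n m)) = m := by
  have hn : 0 < n := by omega
  rw [(LinearEquiv.ofBijective _ ⟨injective_lastCoordinates_domRestrict K n m hn,
    surjective_lastCoordinates_domRestrict K n m hn hmn⟩).finrank_eq, Module.finrank_fin_fun]
end

section
/- The map h restricted to CPar is injective: if f, f' ∈ CPar and f − f' lies in the subgroup G₀, then f = f'. (Abstract form of the injectivity assertion of Proposition 4.1: the canonical map h_C from the set of C-parameters to G(Rep_{D,ss}(W_F))/G₀(Rep_{D,ss}(W_F)) is injective.) -/
/-! Abstract setting for the combinatorics of Section 4 of the paper: `ι` indexes pairs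
`(ℤ_Ψ, k)` of an irreducible line and a length, `o i ≥ 1` is the cardinality of the line.
`Sum.inl ⟨i, j⟩` models the indecomposable nilpotent Deligne representation `[0,k-1] ⊗ ν^j Ψ`
and `Sum.inr i` models the cycle representation `[0,k-1] ⊗ 𝒞(ℤ_Ψ)`. -/

/-- The basis `B = (Σ i, Fin (o i)) ⊕ ι` of indecomposables. -/
abbrev BB (ι : Type*) (o : ι → ℕ) : Type _ := (Σ i : ι, Fin (o i)) ⊕ ι

/-- The free commutative monoid `M = B →₀ ℕ` on `B`, modelling `[Rep_{D,ss}(W_F)]` under `⊕`. -/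
abbrev MM (ι : Type*) (o : ι → ℕ) : Type _ := BB ι o →₀ ℕ

/-- The Grothendieck group `G = B →₀ ℤ` of `M`. -/
abbrev GG (ι : Type*) (o : ι → ℕ) : Type _ := BB ι o →₀ ℤ

/-- `s_i = Σ_{j : Fin (o i)} inl (i, j)`, modelling `[0,k-1] ⊗ St₀(ℤ_Ψ)`. -/
noncomputable def sElt (ι : Type*) (o : ι → ℕ) (i : ι) : MM ι o :=
  ∑ j : Fin (o i), Finsupp.single (Sum.inl ⟨i, j⟩) 1

/-- `c_i = inr i`, modelling the cycle representation `[0,k-1] ⊗ 𝒞(ℤ_Ψ)`. -/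
noncomputable def cElt (ι : Type*) (o : ι → ℕ) (i : ι) : MM ι o :=
  Finsupp.single (Sum.inr i) 1

/-- The canonical embedding of `M` into its Grothendieck group `G`. -/
noncomputable def toG (ι : Type*) (o : ι → ℕ) : MM ι o →+ GG ι o :=
  Finsupp.mapRange.addMonoidHom (Nat.castAddMonoidHom ℤ)

/-- The subgroup `G₀ ≤ G` generated by the differences `s_i - c_i`. -/
noncomputable def Gzero (ι : Type*) (o : ι → ℕ) : AddSubgroup (GG ι o) :=
  AddSubgroup.closure { g | ∃ i : ι, g = toG ι o (sElt ι o i) - toG ι o (cElt ι o i) }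

/-- The quotient map `h : G → G ⧸ G₀`. -/
noncomputable def hq (ι : Type*) (o : ι → ℕ) : GG ι o →+ GG ι o ⧸ Gzero ι o :=
  QuotientAddGroup.mk' (Gzero ι o)

/-- `Nilp`: elements of `M` with no cycle component (nilpotent Deligne representations). -/
def NilpSet (ι : Type*) (o : ι → ℕ) : Set (MM ι o) := { f | ∀ i : ι, f (Sum.inr i) = 0 }

/-- `CPar`: elements of `M` with no complete cycle of nilpotent indecomposables
(C-parameters). -/
def CParSet (ι : Type*) (o : ι → ℕ) : Set (MM ι o) :=
  { f | ∀ i : ι, ∃ j : Fin (o i), f (Sum.inl ⟨i, j⟩) = 0 }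

theorem toG_apply {ι : Type*} (o : ι → ℕ) (f : MM ι o) (b : BB ι o) :
    toG ι o f b = (f b : ℤ) := rfl

theorem sElt_inl {ι : Type*} [DecidableEq ι] (o : ι → ℕ) (i k : ι) (j : Fin (o k)) :
    sElt ι o i (Sum.inl ⟨k, j⟩) = if i = k then 1 else 0 := by
  classical
  rw [sElt, Finsupp.finsetSum_apply]
  split_ifs with h
  · subst h
    simp [Finsupp.single_apply]
  · exact Finset.sum_eq_zero fun l _ => Finsupp.single_eq_of_ne (by grind)

theorem sElt_inr {ι : Type*} (o : ι → ℕ) (i k : ι) : sElt ι o i (Sum.inr k) = 0 := by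
  simp [sElt, Finsupp.finsetSum_apply]

theorem cElt_inl {ι : Type*} (o : ι → ℕ) (i : ι) (x : Σ k, Fin (o k)) :
    cElt ι o i (Sum.inl x) = 0 := by
  simp [cElt]

theorem cElt_inr {ι : Type*} [DecidableEq ι] (o : ι → ℕ) (i k : ι) :
    cElt ι o i (Sum.inr k) = if i = k then 1 else 0 := by
  simp [cElt, Finsupp.single_apply]

/-- On `G₀`, every coefficient along a line is the negative of the coefficient of its cycle. -/
theorem apply_inl_add_apply_inr_of_mem_Gzero {ι : Type*} (o : ι → ℕ) {g : GG ι o}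
    (hg : g ∈ Gzero ι o) (k : ι) (j : Fin (o k)) :
    g (Sum.inl ⟨k, j⟩) + g (Sum.inr k) = 0 := by
  classical
  induction hg using AddSubgroup.closure_induction with
  | mem g hg =>
    obtain ⟨i, rfl⟩ := hg
    simp only [Finsupp.sub_apply, toG_apply, sElt_inl, sElt_inr, cElt_inl, cElt_inr]
    split_ifs <;> simp
  | zero => simp
  | add a b _ _ ha hb =>
    simp only [Finsupp.add_apply]
    linarith
  | neg a _ ha =>
    simp only [Finsupp.neg_apply]
    linarith

/-- Abstract form of the injectivity assertion of Proposition 4.1: the canonical map `h_C`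
from the set of C-parameters to `G(Rep_{D,ss}(W_F)) ⧸ G₀(Rep_{D,ss}(W_F))` is injective. -/
theorem h_injective_on_CPar
    {ι : Type*} (o : ι → ℕ) (ho : ∀ i, 1 ≤ o i)
    (f f' : MM ι o) (hf : f ∈ CParSet ι o) (hf' : f' ∈ CParSet ι o)
    (hdiff : toG ι o f - toG ι o f' ∈ Gzero ι o) : f = f' := by
  have key (i : ι) (j : Fin (o i)) :
      (f (Sum.inl ⟨i, j⟩) : ℤ) - f' (Sum.inl ⟨i, j⟩) + (f (Sum.inr i) - f' (Sum.inr i)) = 0 :=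
    apply_inl_add_apply_inr_of_mem_Gzero o hdiff i j
  have cycle (i : ι) : f (Sum.inr i) = f' (Sum.inr i) := by
    obtain ⟨j, hj⟩ := hf i
    obtain ⟨j', hj'⟩ := hf' i
    have h := key i j
    have h' := key i j'
    omega
  ext (⟨i, j⟩ | i)
  · have h := key i j
    have h' := cycle i
    omega
  · exact cycle i
end

section
/- The image h(CPar) of the set of C-parameters in the quotient group G ⧸ G₀ is closed under addition: it contains h(0), and for all x, y ∈ h(CPar) one has x + y ∈ h(CPar). In particular this endows CPar with a natural commutative monoid structure. (Abstract form of the second assertion of Proposition 4.1.) -/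
/-- `s_i ≤ f` as soon as `f` contains a complete cycle of nilpotent indecomposables at `i`. -/
lemma sElt_le {ι : Type*} {o : ι → ℕ} {f : MM ι o} {i : ι}
    (hf : ∀ j : Fin (o i), f (Sum.inl ⟨i, j⟩) ≠ 0) : sElt ι o i ≤ f := by
  classical
  intro b
  simp only [sElt, Finsupp.finsetSum_apply, Finsupp.single_apply]
  by_cases hb : ∃ j : Fin (o i), Sum.inl ⟨i, j⟩ = b
  · obtain ⟨j, rfl⟩ := hb
    simpa [Nat.one_le_iff_ne_zero] using hf j
  · push Not at hb
    simp [hb]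

lemma hq_toG_sElt {ι : Type*} {o : ι → ℕ} (i : ι) :
    hq ι o (toG ι o (sElt ι o i)) = hq ι o (toG ι o (cElt ι o i)) := by
  rw [← sub_eq_zero, ← map_sub]
  exact (QuotientAddGroup.eq_zero_iff _).2 (AddSubgroup.subset_closure ⟨i, rfl⟩)

/-- Every element of `M` has the same image in `G ⧸ G₀` as some C-parameter: replace complete
cycles `s_i` by `c_i`, which lowers the number of nilpotent indecomposables. -/
lemma exists_mem_CParSet_hq_eq {ι : Type*} {o : ι → ℕ} (ho : ∀ i, 1 ≤ o i) (f : MM ι o) :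
    ∃ g ∈ CParSet ι o, hq ι o (toG ι o g) = hq ι o (toG ι o f) := by
  induction hn : Finsupp.weight (Sum.elim (fun _ => 1) (fun _ => 0) : BB ι o → ℕ) f
    using Nat.strong_induction_on generalizing f with
  | _ n ih =>
    by_cases hf : f ∈ CParSet ι o
    · exact ⟨f, hf, rfl⟩
    · simp only [CParSet, Set.mem_ofPred_eq, not_forall, not_exists] at hf
      obtain ⟨i, hi⟩ := hf
      obtain ⟨r, rfl⟩ := exists_add_of_le (sElt_le hi)
      obtain ⟨g, hg, hgr⟩ := ih _ (by
        have := ho i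
        rw [← hn]
        simp [sElt, cElt, Finsupp.weight_single]
        omega) (cElt ι o i + r) rfl
      exact ⟨g, hg, by rw [hgr, map_add, map_add, map_add, map_add, hq_toG_sElt]⟩

/-- Abstract form of the second assertion of Proposition 4.1: the image `h(CPar)` of the set
of C-parameters in `G ⧸ G₀` contains `h(0)` and is closed under addition, so it endows `CPar`
with a natural commutative monoid structure. -/
theorem image_CPar_addSubmonoid
    {ι : Type*} (o : ι → ℕ) (ho : ∀ i, 1 ≤ o i) :
    hq ι o (toG ι o 0) ∈ (fun f => hq ι o (toG ι o f)) '' CParSet ι o ∧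
    ∀ x y : GG ι o ⧸ Gzero ι o,
      x ∈ (fun f => hq ι o (toG ι o f)) '' CParSet ι o →
      y ∈ (fun f => hq ι o (toG ι o f)) '' CParSet ι o →
      x + y ∈ (fun f => hq ι o (toG ι o f)) '' CParSet ι o := by
  constructor
  · exact exists_mem_CParSet_hq_eq ho 0
  · rintro _ _ ⟨f, -, rfl⟩ ⟨g, -, rfl⟩
    simpa only [Set.mem_image, map_add] using exists_mem_CParSet_hq_eq ho (f + g)
end

section
/- The map h restricted to Nilp is injective: if f, f' ∈ Nilp and f − f' lies in the subgroup G₀, then f = f'. (Abstract form of the injectivity assertion of Proposition 4.3: the restriction h_Nilp of the canonical projection to Nilp_{D,ss}(W_F) is injective.) -/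
/-- On `G₀`, the coefficient at each `inl (i, j)` is the negative of that at `inr i`. -/
theorem apply_inl_eq_neg_apply_inr_of_mem_Gzero {ι : Type*} {o : ι → ℕ} {g : GG ι o}
    (hg : g ∈ Gzero ι o) (i : ι) (j : Fin (o i)) :
    g (Sum.inl ⟨i, j⟩) = -g (Sum.inr i) := by
  classical
  induction hg using AddSubgroup.closure_induction with
  | mem g hg =>
    obtain ⟨k, rfl⟩ := hg
    by_cases hk : k = i
    · subst hk
      simp [toG, sElt, cElt, Finsupp.single_apply]
    · simp [toG, sElt, cElt, hk]
  | zero => simp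
  | add x y _ _ hx hy => simp [hx, hy, add_comm]
  | neg x _ hx => simp [hx]

/-- Abstract form of the injectivity assertion of Proposition 4.3: the restriction `h_Nilp`
of the canonical projection to `Nilp_{D,ss}(W_F)` is injective. -/
theorem h_injective_on_Nilp
    {ι : Type*} (o : ι → ℕ) (ho : ∀ i, 1 ≤ o i)
    (f f' : MM ι o) (hf : f ∈ NilpSet ι o) (hf' : f' ∈ NilpSet ι o)
    (hdiff : toG ι o f - toG ι o f' ∈ Gzero ι o) : f = f' := by
  ext b
  rcases b with ⟨i, j⟩ | i
  · have h := apply_inl_eq_neg_apply_inr_of_mem_Gzero hdiff i j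
    simp only [toG, Finsupp.mapRange.addMonoidHom_apply, Finsupp.sub_apply,
      Finsupp.mapRange_apply, Nat.coe_castAddMonoidHom, hf i, hf' i] at h
    omega
  · rw [hf i, hf' i]
end

section
/- The map CV is a bijection from Nilp onto CPar satisfying h(CV f) = h(f) for every f ∈ Nilp; moreover CV is the unique map from Nilp to CPar satisfying h ∘ CV = h on Nilp. (Abstract form of Corollary 4.4: CV = h_C^{-1} ∘ h_Nilp is a bijection from Nilp_{D,ss}(W_F) to the set of C-parameters.) -/
/-- `n_i = min_{j : Fin (o i)} f (inl (i, j))`, as a finitely supported family. -/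
noncomputable def nmin (ι : Type*) [DecidableEq ι] (o : ι → ℕ) (ho : ∀ i, 1 ≤ o i)
    (f : MM ι o) : ι →₀ ℕ :=
  Finsupp.onFinset (f.support.image (Sum.elim (fun p => p.1) id))
    (fun i => Finset.univ.inf' (Finset.univ_nonempty_iff.mpr ⟨⟨0, ho i⟩⟩)
      (fun j : Fin (o i) => f (Sum.inl ⟨i, j⟩)))
    (by
      intro i hi
      have hj : f (Sum.inl ⟨i, ⟨0, ho i⟩⟩) ≠ 0 := by
        intro h0
        exact hi (le_antisymm
          (le_trans (Finset.inf'_le _ (Finset.mem_univ (⟨0, ho i⟩ : Fin (o i)))) h0.le)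
          (Nat.zero_le _))
      exact Finset.mem_image.mpr
        ⟨Sum.inl ⟨i, ⟨0, ho i⟩⟩, Finsupp.mem_support_iff.mpr hj, rfl⟩)

/-- The map `CV : f ↦ (f - Σ_i n_i • s_i) + Σ_i n_i • c_i`, where
`n_i = min_{j : Fin (o i)} f (inl (i, j))`: it replaces each complete cycle of nilpotent
indecomposables by the corresponding cycle representation. -/
noncomputable def CV (ι : Type*) [DecidableEq ι] (o : ι → ℕ) (ho : ∀ i, 1 ≤ o i)
    (f : MM ι o) : MM ι o :=
  (f - (nmin ι o ho f).sum fun i k => k • sElt ι o i)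
    + (nmin ι o ho f).sum fun i k => k • cElt ι o i

theorem sum_smul_sElt_inl {ι : Type*} (o : ι → ℕ) (n : ι →₀ ℕ) (i : ι) (j : Fin (o i)) :
    (n.sum fun i k => k • sElt ι o i) (Sum.inl ⟨i, j⟩) = n i := by
  classical
  rw [Finsupp.sum_apply, Finsupp.sum_eq_single i]
  · simp [sElt, Finsupp.single_apply]
  · intro a _ hai
    simp [sElt, hai]
  · simp

theorem sum_smul_sElt_inr {ι : Type*} (o : ι → ℕ) (n : ι →₀ ℕ) (i : ι) :
    (n.sum fun i k => k • sElt ι o i) (Sum.inr i) = 0 := by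
  classical
  rw [Finsupp.sum_apply]
  simp [sElt]

theorem sum_smul_cElt_inl {ι : Type*} (o : ι → ℕ) (n : ι →₀ ℕ) (p : Σ i, Fin (o i)) :
    (n.sum fun i k => k • cElt ι o i) (Sum.inl p) = 0 := by
  classical
  rw [Finsupp.sum_apply]
  simp [cElt]

theorem sum_smul_cElt_inr {ι : Type*} (o : ι → ℕ) (n : ι →₀ ℕ) (i : ι) :
    (n.sum fun i k => k • cElt ι o i) (Sum.inr i) = n i := by
  classical
  rw [Finsupp.sum_apply, Finsupp.sum_eq_single i]
  · simp [cElt]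
  · intro a _ hai
    simp [cElt, hai]
  · simp

theorem hq_sElt {ι : Type*} (o : ι → ℕ) (i : ι) :
    hq ι o (toG ι o (sElt ι o i)) = hq ι o (toG ι o (cElt ι o i)) := by
  rw [← sub_eq_zero, ← map_sub]
  exact (QuotientAddGroup.eq_zero_iff _).mpr (AddSubgroup.subset_closure ⟨i, rfl⟩)

section
variable {ι : Type*} [DecidableEq ι] (o : ι → ℕ) (ho : ∀ i, 1 ≤ o i)

theorem nmin_le (f : MM ι o) (i : ι) (j : Fin (o i)) :
    nmin ι o ho f i ≤ f (Sum.inl ⟨i, j⟩) :=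
  Finset.inf'_le _ (Finset.mem_univ j)

theorem exists_eq_nmin (f : MM ι o) (i : ι) :
    ∃ j : Fin (o i), f (Sum.inl ⟨i, j⟩) = nmin ι o ho f i := by
  obtain ⟨j, -, hj⟩ := Finset.exists_mem_eq_inf' (Finset.univ_nonempty_iff.mpr ⟨⟨0, ho i⟩⟩)
    (fun j : Fin (o i) => f (Sum.inl ⟨i, j⟩))
  exact ⟨j, hj.symm⟩

theorem CV_mem_CParSet (f : MM ι o) : CV ι o ho f ∈ CParSet ι o := by
  intro i
  obtain ⟨j, hj⟩ := exists_eq_nmin o ho f i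
  refine ⟨j, ?_⟩
  simp only [CV, Finsupp.add_apply, Finsupp.tsub_apply, sum_smul_sElt_inl, sum_smul_cElt_inl]
  omega

theorem CV_add_sum_sElt (f : MM ι o) :
    CV ι o ho f + (nmin ι o ho f).sum (fun i k => k • sElt ι o i)
      = f + (nmin ι o ho f).sum (fun i k => k • cElt ι o i) := by
  ext (⟨i, j⟩ | i)
  · have := nmin_le o ho f i j
    simp only [CV, Finsupp.add_apply, Finsupp.tsub_apply, sum_smul_sElt_inl, sum_smul_cElt_inl]
    omega
  · simp only [CV, Finsupp.add_apply, Finsupp.tsub_apply, sum_smul_sElt_inr, sum_smul_cElt_inr]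
    omega

theorem hq_CV (f : MM ι o) : hq ι o (toG ι o (CV ι o ho f)) = hq ι o (toG ι o f) := by
  have h := congrArg (fun x => hq ι o (toG ι o x)) (CV_add_sum_sElt o ho f)
  simp only [Finsupp.sum, map_add, map_sum, map_nsmul, hq_sElt] at h
  exact add_right_cancel h

end

/-- Elements of `M` with the same class modulo `G₀` have the same value of
`f (inl (i, j)) + f (inr i)`. -/
theorem add_eq_add_of_hq_eq {ι : Type*} (o : ι → ℕ) {f g : MM ι o}
    (h : hq ι o (toG ι o f) = hq ι o (toG ι o g)) (i : ι) (j : Fin (o i)) :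
    f (Sum.inl ⟨i, j⟩) + f (Sum.inr i) = g (Sum.inl ⟨i, j⟩) + g (Sum.inr i) := by
  classical
  let φ : GG ι o →+ ℤ :=
    Finsupp.applyAddHom (Sum.inl ⟨i, j⟩) + Finsupp.applyAddHom (Sum.inr i)
  have hle : Gzero ι o ≤ φ.ker := by
    rw [Gzero, AddSubgroup.closure_le]
    rintro _ ⟨a, rfl⟩
    by_cases hai : a = i
    · subst hai
      simp [φ, toG, sElt, cElt, Finsupp.single_apply]
    · simp [φ, toG, sElt, cElt, hai]
  have hmem : toG ι o f - toG ι o g ∈ Gzero ι o := by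
    rw [← QuotientAddGroup.eq_zero_iff]
    change hq ι o _ = 0
    rw [map_sub, h, sub_self]
  have hφ : φ (toG ι o f - toG ι o g) = 0 := hle hmem
  simp only [φ, toG, map_sub, AddMonoidHom.add_apply, Finsupp.applyAddHom_apply,
    Finsupp.mapRange.addMonoidHom_apply, Finsupp.mapRange_apply, Nat.coe_castAddMonoidHom] at hφ
  omega

theorem CParSet_ext {ι : Type*} (o : ι → ℕ) {f g : MM ι o}
    (hf : f ∈ CParSet ι o) (hg : g ∈ CParSet ι o)
    (h : ∀ (i : ι) (j : Fin (o i)),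
      f (Sum.inl ⟨i, j⟩) + f (Sum.inr i) = g (Sum.inl ⟨i, j⟩) + g (Sum.inr i)) :
    f = g := by
  have hr (i : ι) : f (Sum.inr i) = g (Sum.inr i) := by
    obtain ⟨j, hj⟩ := hf i
    obtain ⟨l, hl⟩ := hg i
    have h₁ := h i j
    have h₂ := h i l
    omega
  ext (⟨i, j⟩ | i)
  · have h₁ := h i j
    have h₂ := hr i
    omega
  · exact hr i

theorem NilpSet_ext {ι : Type*} (o : ι → ℕ) {f g : MM ι o}
    (hf : f ∈ NilpSet ι o) (hg : g ∈ NilpSet ι o)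
    (h : ∀ (i : ι) (j : Fin (o i)),
      f (Sum.inl ⟨i, j⟩) + f (Sum.inr i) = g (Sum.inl ⟨i, j⟩) + g (Sum.inr i)) :
    f = g := by
  ext (⟨i, j⟩ | i)
  · have h₁ := h i j
    rwa [hf i, hg i] at h₁
  · rw [hf i, hg i]

theorem exists_mem_NilpSet {ι : Type*} (o : ι → ℕ) (g : MM ι o) :
    ∃ f ∈ NilpSet ι o, ∀ (i : ι) (j : Fin (o i)),
      f (Sum.inl ⟨i, j⟩) + f (Sum.inr i) = g (Sum.inl ⟨i, j⟩) + g (Sum.inr i) := by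
  let n : ι →₀ ℕ := g.comapDomain Sum.inr Sum.inr_injective.injOn
  have hn (i : ι) : n i = g (Sum.inr i) := rfl
  have hr (i : ι) : ((g - n.sum fun i k => k • cElt ι o i) + n.sum fun i k => k • sElt ι o i)
      (Sum.inr i) = 0 := by
    simp only [Finsupp.add_apply, Finsupp.tsub_apply, sum_smul_sElt_inr, sum_smul_cElt_inr, hn]
    omega
  refine ⟨_, hr, fun i j => ?_⟩
  rw [hr]
  simp only [Finsupp.add_apply, Finsupp.tsub_apply, sum_smul_sElt_inl, sum_smul_cElt_inl, hn]
  omega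

/-- Abstract form of Corollary 4.4: `CV = h_C⁻¹ ∘ h_Nilp` is a bijection from
`Nilp_{D,ss}(W_F)` onto the set of C-parameters, satisfies `h ∘ CV = h` on `Nilp`, and is the
unique map from `Nilp` to `CPar` with this property. -/
theorem CV_bijective_and_unique
    {ι : Type*} [DecidableEq ι] (o : ι → ℕ) (ho : ∀ i, 1 ≤ o i) :
    Set.BijOn (CV ι o ho) (NilpSet ι o) (CParSet ι o) ∧
    (∀ f ∈ NilpSet ι o, hq ι o (toG ι o (CV ι o ho f)) = hq ι o (toG ι o f)) ∧
    ∀ Φ : MM ι o → MM ι o,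
      (∀ f ∈ NilpSet ι o, Φ f ∈ CParSet ι o) →
      (∀ f ∈ NilpSet ι o, hq ι o (toG ι o (Φ f)) = hq ι o (toG ι o f)) →
      ∀ f ∈ NilpSet ι o, Φ f = CV ι o ho f := by
  refine ⟨⟨fun f _ => CV_mem_CParSet o ho f, fun f hf g hg hfg => ?_, fun g hg => ?_⟩,
    fun f _ => hq_CV o ho f, fun Φ hΦ hhΦ f hf => ?_⟩
  · refine NilpSet_ext o hf hg (add_eq_add_of_hq_eq o ?_)
    rw [← hq_CV o ho f, ← hq_CV o ho g, hfg]
  · obtain ⟨f, hf, hfg⟩ := exists_mem_NilpSet o g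
    exact ⟨f, hf, CParSet_ext o (CV_mem_CParSet o ho f) hg fun i j =>
      (add_eq_add_of_hq_eq o (hq_CV o ho f) i j).trans (hfg i j)⟩
  · exact CParSet_ext o (hΦ f hf) (CV_mem_CParSet o ho f)
      (add_eq_add_of_hq_eq o ((hhΦ f hf).trans (hq_CV o ho f).symm))
end
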